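/- Let ω₀ be an almost symplectic structure on M. Then for every differential p-form ζ on M with p ≤ n, j_ζ(Λ₀^n/n!) = Λ₀^#((−1)^{p(p−1)/2} i_{Λ₀^#(ζ)}(ω₀^n/n!)). -/

import Mathlib

namespace Damianou

noncomputable section

/-- Points of `ℝ^N`. -/
abbrev Pt (N : ℕ) := Fin N → ℝ

/-- Raw coordinate representation of a differential `p`-form (or, dually, of a
`p`-vector field): to each point we assign the array of its components. -/
abbrev Form (N p : ℕ) := Pt N → (Fin p → Fin N) → ℝ

/-- The component array of an alternating (antisymmetric) tensor. -/
def AltArr {N p : ℕ} (f : (Fin p → Fin N) → ℝ) : Prop :=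
  (∀ (I : Fin p → Fin N) (σ : Equiv.Perm (Fin p)),
      f (I ∘ σ) = ((Equiv.Perm.sign σ : ℤ) : ℝ) * f I) ∧
  ∀ I : Fin p → Fin N, ¬ Function.Injective I → f I = 0

/-- `ω` is a (smooth) differential `p`-form on the set `M`. -/
def IsFormOn {N p : ℕ} (ω : Form N p) (M : Set (Pt N)) : Prop :=
  (∀ x ∈ M, AltArr (ω x)) ∧ ∀ I, ContDiffOn ℝ (⊤ : ℕ∞) (fun x => ω x I) M

/-- The pairing `⟨η, P⟩` of a `p`-form with a `p`-vector field, determined by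
`⟨η₁∧⋯∧η_p, X₁∧⋯∧X_p⟩ = det (⟨η_i, X_j⟩)`. -/
def pairF {N p : ℕ} (η P : Form N p) : Pt N → ℝ :=
  fun x => (p.factorial : ℝ)⁻¹ * ∑ I : Fin p → Fin N, η x I * P x I

/-- Wedge product (determinant convention). -/
def wedgeF {N : ℕ} (p q : ℕ) (ω : Form N p) (η : Form N q) : Form N (p + q) :=
  fun x I => ((p.factorial : ℝ) * (q.factorial : ℝ))⁻¹ *
    ∑ σ : Equiv.Perm (Fin (p + q)), ((Equiv.Perm.sign σ : ℤ) : ℝ) *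
      (ω x fun i => I (σ (Fin.castAdd q i))) * (η x fun j => I (σ (Fin.natAdd p j)))

def smulF {N p : ℕ} (c : ℝ) (ω : Form N p) : Form N p := fun x I => c * ω x I
def fsmulF {N p : ℕ} (c : Pt N → ℝ) (ω : Form N p) : Form N p := fun x I => c x * ω x I
def addF {N p : ℕ} (ω η : Form N p) : Form N p := fun x I => ω x I + η x I
def subF {N p : ℕ} (ω η : Form N p) : Form N p := fun x I => ω x I - η x I

/-- Cast between (propositionally) equal degrees. -/
def castF {N p q : ℕ} (h : p = q) (ω : Form N p) : Form N q :=
  fun x J => ω x fun t => J (Fin.cast h t)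

/-- Total cast, defaulting to `0` when the degrees differ. -/
def castT {N p q : ℕ} (ω : Form N p) : Form N q :=
  if h : p = q then castF h ω else fun _ _ => 0

/-- Partial derivative `∂f/∂x_i`. -/
def pd {N : ℕ} (f : Pt N → ℝ) (i : Fin N) (x : Pt N) : ℝ :=
  fderiv ℝ f x (Pi.single i 1)

/-- The gradient covector of a function. -/
def grad {N : ℕ} (f : Pt N → ℝ) (x : Pt N) : Fin N → ℝ := fun i => pd f i x

/-- The differential of a function, as a `1`-form. -/
def dF {N : ℕ} (f : Pt N → ℝ) : Form N 1 := fun x I => pd f (I 0) x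

/-- Exterior derivative. -/
def extd {N p : ℕ} (ω : Form N p) : Form N (p + 1) :=
  fun x I => ∑ i : Fin (p + 1), (-1 : ℝ) ^ (i : ℕ) *
    fderiv ℝ (fun y => ω y fun j => I (i.succAbove j)) x (Pi.single (I i) 1)

/-- Concatenation of index blocks of lengths `a` and `b - a` into `Fin b`. -/
def catIdx {N a b : ℕ} (u : Fin a → Fin N) (v : Fin (b - a) → Fin N) : Fin b → Fin N :=
  fun t => if h : (t : ℕ) < a then u ⟨t, h⟩
    else v ⟨(t : ℕ) - a, by have := t.isLt; omega⟩

/-- Concatenation of index blocks of lengths `b - c` and `c` into `Fin b`. -/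
def catIdx' {N c b : ℕ} (u : Fin (b - c) → Fin N) (v : Fin c → Fin N) : Fin b → Fin N :=
  fun t => if h : (t : ℕ) < b - c then u ⟨t, h⟩
    else v ⟨(t : ℕ) - (b - c), by have := t.isLt; omega⟩

/-- Interior product `i_P η` of a `q`-form `η` by a `p`-vector field `P`;
it satisfies `⟨i_P η, Q⟩ = (-1)^{p(p-1)/2} ⟨η, P ∧ Q⟩`. -/
def iF {N : ℕ} (p q : ℕ) (P : Form N p) (η : Form N q) : Form N (q - p) :=
  fun x J => (-1 : ℝ) ^ (p * (p - 1) / 2) * (p.factorial : ℝ)⁻¹ *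
    ∑ I : Fin p → Fin N, P x I * η x (catIdx I J)

/-- Interior product `j_η P` of an `r`-vector field `P` by a `q`-form `η`;
it satisfies `⟨ζ, j_η P⟩ = ⟨ζ ∧ η, P⟩`. -/
def jF {N : ℕ} (q r : ℕ) (η : Form N q) (P : Form N r) : Form N (r - q) :=
  fun x B => (q.factorial : ℝ)⁻¹ * ∑ A : Fin q → Fin N, η x A * P x (catIdx' B A)

/-- The extension of `Λ₀^#` to `p`-forms:
`Λ₀^#(ζ)(α₁,…,α_p) = (-1)^p ζ(Λ₀^#(α₁),…,Λ₀^#(α_p))`, in coordinates. -/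
def sharpF {N : ℕ} (Λ : Form N 2) (p : ℕ) (ζ : Form N p) : Form N p :=
  fun x J => (-1 : ℝ) ^ p * ∑ I : Fin p → Fin N, ζ x I * ∏ t, Λ x ![I t, J t]

/-- `Λ^#` applied to a covector: `⟨β, Λ^#(α)⟩ = Λ(α,β)`. -/
def sharpV {N : ℕ} (Λ : Form N 2) (α : Fin N → ℝ) (x : Pt N) : Fin N → ℝ :=
  fun j => ∑ i, Λ x ![i, j] * α i

/-- The hamiltonian vector field `X_f = Λ₀^#(df)`. -/
def hamV {N : ℕ} (Λ : Form N 2) (f : Pt N → ℝ) (x : Pt N) : Fin N → ℝ :=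
  sharpV Λ (grad f x) x

/-- Coefficient matrix of a 2-form (or of a bivector field) at a point. -/
def mat2 {N : ℕ} (ω : Form N 2) (x : Pt N) : Matrix (Fin N) (Fin N) ℝ :=
  Matrix.of fun i j => ω x ![i, j]

/-- The bracket `{g,h} = Λ(dg,dh)` associated with a bivector field. -/
def braF {N : ℕ} (Λ : Form N 2) (g h : Pt N → ℝ) : Pt N → ℝ :=
  fun x => ∑ i, ∑ j, Λ x ![i, j] * pd g i x * pd h j x

/-- The Jacobi identity for the bracket of `Λ`, for all functions smooth on `M`. -/
def JacobiOn {N : ℕ} (Λ : Form N 2) (M : Set (Pt N)) : Prop :=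
  ∀ g h k : Pt N → ℝ, ContDiffOn ℝ (⊤ : ℕ∞) g M → ContDiffOn ℝ (⊤ : ℕ∞) h M →
    ContDiffOn ℝ (⊤ : ℕ∞) k M →
    ∀ x ∈ M, braF Λ g (braF Λ h k) x + braF Λ h (braF Λ k g) x + braF Λ k (braF Λ g h) x = 0

/-- `f` is a Casimir of `Λ` on `M`, i.e. `Λ(df,·) = 0` on `M`. -/
def CasimirOn {N : ℕ} (Λ : Form N 2) (f : Pt N → ℝ) (M : Set (Pt N)) : Prop :=
  ∀ x ∈ M, ∀ b, ∑ a, Λ x ![a, b] * grad f x a = 0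

/-- Wedge powers of a `2`-form (or of a bivector field). -/
def wpow {N : ℕ} (ω : Form N 2) : (m : ℕ) → Form N (2 * m)
  | 0 => fun _ _ => 1
  | m + 1 => wedgeF (2 * m) 2 (wpow ω m) ω

/-- The wedge `α₁ ∧ ⋯ ∧ α_m` of a family of `1`-forms. -/
def wedgeList {N : ℕ} : (m : ℕ) → (Fin m → Form N 1) → Form N m
  | 0, _ => fun _ _ => 1
  | m + 1, α => wedgeF m 1 (wedgeList m fun i => α i.castSucc) (α (Fin.last m))

/-- `ω₀` is an almost symplectic structure on `M` with associated (nondegenerate)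
bivector field `Λ₀`:  `Λ₀^#` is the inverse of `X ↦ -ω₀(X,·)`, which in coordinates
reads `(mat2 ω₀ x) * (mat2 Λ₀ x) = -1`. -/
def AlmostSymp {N : ℕ} (ω₀ Λ₀ : Form N 2) (M : Set (Pt N)) : Prop :=
  IsFormOn ω₀ M ∧ IsFormOn Λ₀ M ∧ ∀ x ∈ M, mat2 ω₀ x * mat2 Λ₀ x = -1

/-- `ωⁿ/n!`; for an almost symplectic `ω₀` on `ℝ^{2n}` this is the volume form `Ω`,
and for `Λ₀` it is the dual `2n`-vector field `Ω̃`. -/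
def volF {N : ℕ} (n : ℕ) (ω : Form N 2) : Form N (2 * n) :=
  smulF ((n.factorial : ℝ)⁻¹) (wpow ω n)

/-- The adjoint `*φ = (-1)^{p(p-1)/2} i_{Λ₀^#(φ)} (ω₀ⁿ/n!)` of a `p`-form. -/
def adjF {n : ℕ} (ω₀ Λ₀ : Form (2 * n) 2) (p : ℕ) (φ : Form (2 * n) p) :
    Form (2 * n) (2 * n - p) :=
  smulF ((-1 : ℝ) ^ (p * (p - 1) / 2)) (iF p (2 * n) (sharpF Λ₀ p φ) (volF n ω₀))

/-- The codifferential `δ = * ∘ d ∘ *`. -/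
def codiffF {n : ℕ} (ω₀ Λ₀ : Form (2 * n) 2) (p : ℕ) (φ : Form (2 * n) p) :
    Form (2 * n) (p - 1) :=
  castT (adjF ω₀ Λ₀ (2 * n - p + 1) (extd (adjF ω₀ Λ₀ p φ)))

/-- The compatibility condition `2 σ ∧ δ(σ) = δ(σ ∧ σ)` on `M`. -/
def DeltaCond {n : ℕ} (ω₀ Λ₀ σ : Form (2 * n) 2) (M : Set (Pt (2 * n))) : Prop :=
  ∀ x ∈ M, ∀ I : Fin 3 → Fin (2 * n),
    smulF 2 (wedgeF 2 1 σ (codiffF ω₀ Λ₀ 2 σ)) x I = codiffF ω₀ Λ₀ 4 (wedgeF 2 2 σ σ) x I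

/-- Pullback of a component array along the linear substitution with matrix `B`. -/
def pullArr {N p : ℕ} (B : Fin N → Fin N → ℝ) (f : (Fin p → Fin N) → ℝ) :
    (Fin p → Fin N) → ℝ :=
  fun J => ∑ I : Fin p → Fin N, f I * ∏ t, B (I t) (J t)

/-- Wedge products commute with linear substitutions. -/
theorem pullArr_wedgeF {N p q : ℕ} (B : Fin N → Fin N → ℝ) (ω : Form N p) (η : Form N q)
    (ω' : Form N p) (η' : Form N q) (x : Pt N)
    (hω : pullArr B (ω x) = ω' x) (hη : pullArr B (η x) = η' x) :
    pullArr B (wedgeF p q ω η x) = wedgeF p q ω' η' x := by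
  funext J
  simp only [pullArr, wedgeF, ← hω, ← hη, mul_assoc, Finset.mul_sum, Finset.sum_mul]
  rw [Finset.sum_comm]
  refine Finset.sum_congr rfl fun σ _ => ?_
  rw [Finset.sum_comm, ← Equiv.sum_comp (σ.arrowCongr (Equiv.refl (Fin N))),
    ← (Fin.appendEquiv p q).sum_comp, Fintype.sum_prod_type]
  refine Finset.sum_congr rfl fun I _ => Finset.sum_congr rfl fun K _ => ?_
  have hprod : ∏ t, B (σ.arrowCongr (Equiv.refl (Fin N)) (Fin.appendEquiv p q (I, K)) t) (J t) =
      (∏ i, B (I i) (J (σ (Fin.castAdd q i)))) * ∏ j, B (K j) (J (σ (Fin.natAdd p j))) := by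
    rw [← Equiv.prod_comp σ, Fin.prod_univ_add]
    simp [Equiv.arrowCongr, Fin.appendEquiv]
  rw [hprod]
  simp only [Equiv.arrowCongr_apply, Equiv.coe_refl, Function.comp_apply, id_eq,
    Equiv.symm_apply_apply, Fin.appendEquiv, Equiv.coe_fn_mk, Fin.append_left, Fin.append_right]
  ring

theorem pullArr_smul {N p : ℕ} (B : Fin N → Fin N → ℝ) (c : ℝ) (f : (Fin p → Fin N) → ℝ) :
    pullArr B (fun I => c * f I) = fun J => c * pullArr B f J := by
  funext J
  simp only [pullArr, Finset.mul_sum, mul_assoc]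

theorem pullArr_wpow {N : ℕ} (B : Fin N → Fin N → ℝ) (ω ω' : Form N 2) (x : Pt N)
    (h : pullArr B (ω x) = ω' x) (m : ℕ) : pullArr B (wpow ω m x) = wpow ω' m x := by
  induction m with
  | zero =>
    funext J
    simp [pullArr, wpow]
  | succ m ih => exact pullArr_wedgeF B _ _ _ _ x ih h

theorem pullArr_volF {N : ℕ} (B : Fin N → Fin N → ℝ) (ω ω' : Form N 2) (x : Pt N)
    (h : pullArr B (ω x) = ω' x) (m : ℕ) : pullArr B (volF m ω x) = volF m ω' x := by
  have := pullArr_smul B ((m.factorial : ℝ)⁻¹) (wpow ω m x)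
  rw [pullArr_wpow B ω ω' x h] at this
  exact this

theorem wedgeF_comp_perm {N p q : ℕ} (ω : Form N p) (η : Form N q) (x : Pt N)
    (I : Fin (p + q) → Fin N) (τ : Equiv.Perm (Fin (p + q))) :
    wedgeF p q ω η x (I ∘ τ) = ((Equiv.Perm.sign τ : ℤ) : ℝ) * wedgeF p q ω η x I := by
  simp only [wedgeF]
  rw [mul_left_comm]
  congr 1
  rw [Finset.mul_sum, ← Equiv.sum_comp (Equiv.mulLeft τ⁻¹)]
  refine Finset.sum_congr rfl fun σ _ => ?_
  simp [mul_assoc]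

theorem wpow_comp_perm {N : ℕ} (ω : Form N 2) (x : Pt N) (m : ℕ)
    (I : Fin (2 * m) → Fin N) (τ : Equiv.Perm (Fin (2 * m))) :
    wpow ω m x (I ∘ τ) = ((Equiv.Perm.sign τ : ℤ) : ℝ) * wpow ω m x I := by
  cases m with
  | zero =>
    have : τ = 1 := Subsingleton.elim (α := Equiv.Perm (Fin 0)) _ _
    simp [this]
  | succ m => exact wedgeF_comp_perm _ _ x I τ

theorem volF_comp_perm {N : ℕ} (ω : Form N 2) (x : Pt N) (m : ℕ)
    (I : Fin (2 * m) → Fin N) (τ : Equiv.Perm (Fin (2 * m))) :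
    volF m ω x (I ∘ τ) = ((Equiv.Perm.sign τ : ℤ) : ℝ) * volF m ω x I := by
  simp only [volF, smulF, wpow_comp_perm]
  ring

theorem finRotate_pow_val {N : ℕ} (k : ℕ) (t : Fin N) :
    (((finRotate N ^ k) t : Fin N) : ℕ) = (t + k) % N := by
  have : NeZero N := ⟨by have := t.isLt; omega⟩
  induction k with
  | zero => simp [Nat.mod_eq_of_lt t.isLt]
  | succ k ih =>
    rw [pow_succ', Equiv.Perm.mul_apply, finRotate_apply, Fin.val_add, ih, Fin.val_one']
    simp [← add_assoc]

theorem catIdx'_eq_catIdx_comp {N a b : ℕ} (hab : a ≤ b) (u : Fin a → Fin N)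
    (v : Fin (b - a) → Fin N) : catIdx' v u = catIdx u v ∘ (finRotate b ^ a) := by
  funext t
  have ht := t.isLt
  have hval := finRotate_pow_val a t
  simp only [catIdx', catIdx, Function.comp_apply]
  by_cases h : (t : ℕ) < b - a
  · rw [Nat.mod_eq_of_lt (by omega)] at hval
    rw [dif_pos h, dif_neg (by omega)]
    congr 1
    ext
    simp only [hval]
    omega
  · rw [Nat.mod_eq_sub_mod (by omega), Nat.mod_eq_of_lt (by omega)] at hval
    rw [dif_neg h, dif_pos (by omega)]
    congr 1
    ext
    simp only [hval]
    omega

/-- Moving a block of length `a` past the remaining indices changes a top power by `(-1)^a`. -/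
theorem volF_catIdx' {N m a : ℕ} (ω : Form N 2) (x : Pt N) (hm : 1 ≤ m) (ha : a ≤ 2 * m)
    (u : Fin a → Fin N) (v : Fin (2 * m - a) → Fin N) :
    volF m ω x (catIdx' v u) = (-1) ^ a * volF m ω x (catIdx u v) := by
  have hsign : Equiv.Perm.sign (finRotate (2 * m)) = -1 := by
    obtain ⟨k, rfl⟩ : ∃ k, m = k + 1 := ⟨m - 1, by omega⟩
    rw [show 2 * (k + 1) = 2 * k + 1 + 1 by ring, sign_finRotate]
    simp [pow_succ, pow_mul]
  rw [catIdx'_eq_catIdx_comp ha, volF_comp_perm, map_pow, hsign]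
  simp

theorem catIdx_eq_append {N a c : ℕ} (u : Fin a → Fin N) (v : Fin (a + c - a) → Fin N) :
    catIdx u v = Fin.append u (v ∘ Fin.cast (by omega)) := by
  funext t
  refine Fin.addCases (fun i => ?_) (fun j => ?_) t
  · simp [catIdx]
  · simp only [catIdx, Fin.val_natAdd, Fin.append_right, Function.comp_apply]
    rw [dif_neg (by omega)]
    congr 1
    ext
    simp

/-- Evaluate a substituted array on a concatenation by summing over the two blocks. -/
theorem pullArr_catIdx {N a b : ℕ} (hab : a ≤ b) (B : Fin N → Fin N → ℝ)
    (f : (Fin b → Fin N) → ℝ) (u : Fin a → Fin N) (v : Fin (b - a) → Fin N) :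
    pullArr B f (catIdx u v) = ∑ K : Fin (b - a) → Fin N, ∑ I : Fin a → Fin N,
      f (catIdx I K) * ((∏ t, B (I t) (u t)) * ∏ t, B (K t) (v t)) := by
  obtain ⟨c, rfl⟩ := Nat.exists_eq_add_of_le hab
  have hc : a + c - a = c := by omega
  rw [pullArr, ← (Fin.appendEquiv a c).sum_comp, Fintype.sum_prod_type, Finset.sum_comm,
    ← Equiv.sum_comp ((finCongr hc).arrowCongr (Equiv.refl (Fin N)))]
  refine Finset.sum_congr rfl fun K _ => Finset.sum_congr rfl fun I _ => ?_
  have hK : Fin.appendEquiv a c (I, (finCongr hc).arrowCongr (Equiv.refl (Fin N)) K) =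
      catIdx I K := by
    rw [catIdx_eq_append]
    rfl
  rw [hK]
  simp only [catIdx_eq_append, Fin.prod_univ_add, Fin.append_left, Fin.append_right,
    Function.comp_apply]
  congr 2
  exact (finCongr hc).symm.prod_comp fun t => B (K t) (v t)

theorem AltArr.swap {N : ℕ} {f : (Fin 2 → Fin N) → ℝ} (hf : AltArr f) (i j : Fin N) :
    f ![i, j] = -f ![j, i] := by
  have h := hf.1 ![j, i] (Equiv.swap 0 1)
  have hswap : ![j, i] ∘ Equiv.swap 0 1 = ![i, j] := by
    funext t
    fin_cases t <;> rfl
  rw [hswap, Equiv.Perm.sign_swap (by decide)] at h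
  simpa using h

/-- The bivector of an almost symplectic form is the substitution of the form by itself. -/
theorem AlmostSymp.pullArr_eq {N : ℕ} {ω₀ Λ₀ : Form N 2} {M : Set (Pt N)}
    (h : AlmostSymp ω₀ Λ₀ M) {x : Pt N} (hx : x ∈ M) :
    pullArr (fun i j => Λ₀ x ![i, j]) (ω₀ x) = Λ₀ x := by
  funext J
  have hWL : ∀ i b, ∑ j, ω₀ x ![i, j] * Λ₀ x ![j, b] = -(1 : Matrix (Fin N) (Fin N) ℝ) i b :=
    fun i b => congrFun (congrFun (h.2.2 x hx) i) b
  have hJ : J = ![J 0, J 1] := by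
    funext t
    fin_cases t <;> rfl
  calc pullArr (fun i j => Λ₀ x ![i, j]) (ω₀ x) J
      = ∑ i, Λ₀ x ![i, J 0] * ∑ j, ω₀ x ![i, j] * Λ₀ x ![j, J 1] := by
        rw [pullArr, ← (finTwoArrowEquiv (Fin N)).symm.sum_comp, Fintype.sum_prod_type]
        refine Finset.sum_congr rfl fun i _ => ?_
        rw [Finset.mul_sum]
        refine Finset.sum_congr rfl fun j _ => ?_
        simp [finTwoArrowEquiv]
        ring
    _ = -Λ₀ x ![J 1, J 0] := by simp [hWL, Matrix.one_apply]
    _ = Λ₀ x J := by rw [← (h.2.1.1 x hx).swap, ← hJ]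

/-!
STATEMENT 7.  For an almost symplectic structure `ω₀` on `M ⊆ ℝ^{2n}` and any
differential `p`-form `ζ` with `p ≤ n`:
`Ψ⁻¹(ζ) = Λ₀^#(*ζ)`, i.e.
`j_ζ(Λ₀ⁿ/n!) = Λ₀^#((-1)^{p(p-1)/2} i_{Λ₀^#(ζ)}(ω₀ⁿ/n!))`.
-/
theorem psi_inv_eq_sharp_adjoint
    (n : ℕ) (hn : 1 ≤ n)
    (M : Set (Pt (2 * n))) (hMo : IsOpen M) (hMne : M.Nonempty)
    (ω₀ Λ₀ : Form (2 * n) 2) (hsymp : AlmostSymp ω₀ Λ₀ M)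
    (p : ℕ) (hp : p ≤ n)
    (ζ : Form (2 * n) p) (hζ : IsFormOn ζ M) :
    ∀ x ∈ M, ∀ J : Fin (2 * n - p) → Fin (2 * n),
      jF p (2 * n) ζ (volF n Λ₀) x J
        = sharpF Λ₀ (2 * n - p) (adjF ω₀ Λ₀ p ζ) x J := by
  intro x hx J
  have hpN : p ≤ 2 * n := by omega
  have hanti : ∀ i j, Λ₀ x ![i, j] = -Λ₀ x ![j, i] := (hsymp.2.1.1 x hx).swap
  have hvol : ∀ A : Fin p → Fin (2 * n), volF n Λ₀ x (catIdx A J) = _ := fun A => by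
    rw [← pullArr_volF _ ω₀ Λ₀ x (hsymp.pullArr_eq hx) n, pullArr_catIdx hpN]
  have hsign : ((-1 : ℝ) ^ (p * (p - 1) / 2)) * (-1) ^ (p * (p - 1) / 2) = 1 := by
    rw [← mul_pow]
    simp
  have hpar : (-1 : ℝ) ^ (2 * n - p) = (-1) ^ p := by
    rw [neg_one_pow_congr]
    rw [Nat.even_sub hpN]
    simp
  have hprod : ∀ A I : Fin p → Fin (2 * n),
      ∏ t, Λ₀ x ![A t, I t] = (-1) ^ p * ∏ t, Λ₀ x ![I t, A t] := fun A I => by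
    rw [Finset.prod_congr rfl fun t _ => hanti (A t) (I t), Finset.prod_neg]
    simp
  have hone : ((-1 : ℝ) ^ p) * (-1) ^ p = 1 := by
    rw [← mul_pow]
    simp
  have hadj : ∀ K, adjF ω₀ Λ₀ p ζ x K = (p.factorial : ℝ)⁻¹ * ∑ A : Fin p → Fin (2 * n),
      ζ x A * ∑ I : Fin p → Fin (2 * n),
        volF n ω₀ x (catIdx I K) * ∏ t, Λ₀ x ![I t, A t] := fun K => by
    simp only [adjF, smulF, iF, sharpF]
    rw [← mul_assoc, ← mul_assoc, hsign, one_mul]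
    congr 1
    simp only [Finset.mul_sum, Finset.sum_mul]
    rw [Finset.sum_comm]
    refine Finset.sum_congr rfl fun A _ => Finset.sum_congr rfl fun I _ => ?_
    rw [hprod A I]
    linear_combination
      (ζ x A * volF n ω₀ x (catIdx I K) * ∏ t, Λ₀ x ![I t, A t]) * hone
  simp only [jF, volF_catIdx' Λ₀ x hn hpN, sharpF, hvol, hadj, hpar, Finset.mul_sum,
    Finset.sum_mul]
  rw [Finset.sum_comm]
  refine Finset.sum_congr rfl fun K _ => Finset.sum_congr rfl fun A _ =>
    Finset.sum_congr rfl fun I _ => ?_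
  ring

end
end Damianou
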